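/- If W is an admissible Wilson loop diagram with k propagators and n vertices, then for every starting vertex i the Grassmann necklace algorithm terminates in at most n steps (at most one full circuit of the vertices) and assigns exactly k distinct vertices, so that |I_i^W| = k. -/

import Mathlib

open scoped Classical

namespace WLD

/-- A propagator of a Wilson loop diagram on the cyclically ordered vertex set
`ZMod n` (vertex `n` is identified with `0`): an unordered pair of edges, the
edge joining vertex `i` to vertex `i+1` being labelled `i`. -/
abbrev Prp (n : ℕ) := Sym2 (ZMod n)

variable (n : ℕ)

/-- The position of `x` in the linear order `i <_i i+1 <_i ⋯ <_i i-1`. -/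
def ord (i x : ZMod n) : ℕ := (x - i).val

/-- The other end of a propagator `p` having an end on the edge `e`. -/
noncomputable def otherEnd (p : Prp n) (e : ZMod n) : ZMod n :=
  if h : e ∈ p then Sym2.Mem.other h else e

/-- The vertex support `V(p) = {i, i+1, j, j+1}` of the propagator `p = (i,j)`. -/
def supp (p : Prp n) : Finset (ZMod n) :=
  Sym2.lift ⟨fun i j => {i, i + 1, j, j + 1}, fun i j => by
    ext x
    simp only [Finset.mem_insert, Finset.mem_singleton]
    tauto⟩ p

/-- The vertex support `V(Q)` of a set of propagators. -/
def suppSet (Q : Finset (Prp n)) : Finset (ZMod n) := Q.biUnion (supp n)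

/-- `Prop(U)`: the propagators of `P` supported on (a vertex of) `U`. -/
noncomputable def propsOn (P : Finset (Prp n)) (U : Finset (ZMod n)) : Finset (Prp n) :=
  P.filter fun p => (supp n p ∩ U).Nonempty

/-- Two propagators `p = (i,j)` and `q = (k,l)` cross if `i < k < j < l` cyclically. -/
def Crossing (p q : Prp n) : Prop :=
  ∃ i j k l : ZMod n, p = s(i, j) ∧ q = s(k, l) ∧
    0 < ord n i k ∧ ord n i k < ord n i j ∧ ord n i j < ord n i l

/-- Weak admissibility of a Wilson loop diagram. -/
structure IsWeaklyAdmissible (P : Finset (Prp n)) : Prop where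
  dense : ∀ Q ⊆ P, Q.Nonempty → Q.card + 3 ≤ (suppSet n Q).card
  noncross : ∀ p ∈ P, ∀ q ∈ P, ¬ Crossing n p q

/-- Admissibility of a Wilson loop diagram. -/
structure IsAdmissible (P : Finset (Prp n)) : Prop where
  card_add_four_le : P.card + 4 ≤ n
  dense : ∀ Q ⊆ P, Q.Nonempty → Q.card + 3 ≤ (suppSet n Q).card
  noncross : ∀ p ∈ P, ∀ q ∈ P, ¬ Crossing n p q

/-- The length of a propagator `p = (i,j)`:
`min(|[i+1, j]|, |[j+1, i]|)`, the number of vertices on its smaller side. -/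
def plength (p : Prp n) : ℕ :=
  Sym2.lift ⟨fun i j => min ((j - i - 1).val + 1) ((i - j - 1).val + 1),
    fun _ _ => min_comm _ _⟩ p

/-- `InsideDir n i p q` : the propagator `q = (k,l)` lies (weakly) inside the
propagator `p = (i,j)` directed from its end `i`, i.e. `i ≤_i k <_i l ≤_i j`. -/
def InsideDir (i : ZMod n) (p q : Prp n) : Prop :=
  ∃ j k l : ZMod n, p = s(i, j) ∧ q = s(k, l) ∧
    ord n i k < ord n i l ∧ ord n i l ≤ ord n i j

/-- Sorting key measuring how far clockwise of the vertex `a` the relevant end of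
a propagator supported on `a` is attached: ends on the edge `a-1` are clockwise of
ends on the edge `a`, and on a fixed edge an end is the more clockwise the larger
the propagator is (nestedness of noncrossing propagators sharing an edge). -/
noncomputable def cwKey (a : ZMod n) (p : Prp n) : ℕ :=
  if a - 1 ∈ p then n + ord n (a - 1) (otherEnd n p (a - 1))
  else ord n a (otherEnd n p a)

/-- The clockwise-most propagator of `S` supported on the vertex `a`, if any. -/
noncomputable def pickCW (S : Finset (Prp n)) (a : ZMod n) : Option (Prp n) :=
  if h : (S.filter fun p => a ∈ supp n p).Nonempty then
    some (Classical.choose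
      ((S.filter fun p => a ∈ supp n p).exists_max_image (cwKey n a) h))
  else none

/-- The Grassmann necklace algorithm started at the vertex `i`: after `t` steps,
`(gnRun n P i t).1` is the set of propagators not yet deleted, and
`(gnRun n P i t).2` records the vertex assigned to each deleted propagator.
Step `t+1` processes the vertex `i + t`: if some not-yet-deleted propagator is
supported on it, the clockwise-most such propagator is deleted and assigned
that vertex. -/
noncomputable def gnRun (P : Finset (Prp n)) (i : ZMod n) :
    ℕ → Finset (Prp n) × (Prp n → Option (ZMod n))
  | 0 => (P, fun _ => none)
  | t + 1 =>
    match pickCW n (gnRun P i t).1 (i + (t : ZMod n)) with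
    | none => gnRun P i t
    | some p => ((gnRun P i t).1.erase p,
        Function.update (gnRun P i t).2 p (some (i + (t : ZMod n))))

/-- `I_i^W(p)`: the vertex contributed by the propagator `p` to the Grassmann
necklace term `I_i^W` (as an `Option`; the algorithm makes one full circuit of
the vertex set, i.e. runs for `n` steps). -/
noncomputable def gnAssign (P : Finset (Prp n)) (i : ZMod n) (p : Prp n) :
    Option (ZMod n) :=
  (gnRun n P i n).2 p

/-- The Grassmann necklace term `I_i^W` produced by the algorithm. -/
noncomputable def gnSet [NeZero n] (P : Finset (Prp n)) (i : ZMod n) :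
    Finset (ZMod n) :=
  Finset.univ.filter fun v => ∃ p, gnAssign n P i p = some v

/-- The cyclic interval `{a, a+1, …, a + (len-1)}` in `ZMod n`. -/
def cInterval [NeZero n] (a : ZMod n) (len : ℕ) : Finset (ZMod n) :=
  Finset.univ.filter fun x => ord n a x < len

/-- A Grassmann necklace of type `(k, n)`: a cyclic sequence of `k`-element
subsets of the vertex set such that `I_{i+1} = (I_i \ {i}) ∪ {j}` for some `j`
whenever `i ∈ I_i`, and `I_{i+1} = I_i` otherwise. -/
def IsGrassmannNecklace [NeZero n] (k : ℕ) (I : ZMod n → Finset (ZMod n)) : Prop :=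
  (∀ i, (I i).card = k) ∧
  ∀ i : ZMod n,
    (i ∈ I i → ∃ j : ZMod n, I (i + 1) = insert j ((I i).erase i)) ∧
    (i ∉ I i → I (i + 1) = I i)

/-- Independence in the matroid `M(W)`: no subset `U` of `J` supports fewer
propagators than the vertices it contains. -/
def Indep (P : Finset (Prp n)) (J : Finset (ZMod n)) : Prop :=
  ∀ U ⊆ J, U.card ≤ (propsOn n P U).card

/-- `A` is lexicographically smaller than `B` with respect to the order `<_i`:
the `<_i`-least element of the symmetric difference lies in `A`. -/
def LexLt (i : ZMod n) (A B : Finset (ZMod n)) : Prop :=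
  ∃ v, v ∈ A ∧ v ∉ B ∧ ∀ w, ord n i w < ord n i v → (w ∈ A ↔ w ∈ B)

/-- A `+` is placed in the box `(a, b)` of the Le diagram with row labels `I₁`
by the necklace term `Ii`: writing `I₁ \ Ii = {a₁ > ⋯ > a_r}` and
`Ii \ I₁ = {b₁ < ⋯ < b_r}` in the `<₁` order, the plusses are in the boxes
`(a_t, b_t)`. -/
def LePlusAt (I₁ Ii : Finset (ZMod n)) (a b : ZMod n) : Prop :=
  a ∈ I₁ \ Ii ∧ b ∈ Ii \ I₁ ∧
    ((I₁ \ Ii).filter fun x => ord n 1 a < ord n 1 x).card =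
      ((Ii \ I₁).filter fun y => ord n 1 y < ord n 1 b).card

/-- The box `(a, b)` of the Le diagram of the diagram `P` contains a `+`. -/
def LePlus [NeZero n] (P : Finset (Prp n)) (a b : ZMod n) : Prop :=
  ∃ i : ZMod n, LePlusAt n (gnSet n P 1) (gnSet n P i) a b

/-- The number of `+` entries in the Le diagram of the diagram `P`. -/
noncomputable def plusCount [NeZero n] (P : Finset (Prp n)) : ℕ :=
  (Finset.univ.filter fun ab : ZMod n × ZMod n => LePlus n P ab.1 ab.2).card

/-- The length of the row labelled `a` of the Young diagram with row labels `I₁`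
(the boxes of row `a` are indexed by the column labels `b ∉ I₁` with `a <₁ b`). -/
noncomputable def rowLen [NeZero n] (I₁ : Finset (ZMod n)) (a : ZMod n) : ℕ :=
  (Finset.univ.filter fun b => b ∉ I₁ ∧ ord n 1 a < ord n 1 b).card

/-- The entry of the matrix `C(W)` in row `p` and column `q`: the indeterminate
`x_{p,q}` if `q ∈ V(p)`, and `0` otherwise. -/
noncomputable def CW (p : Prp n) (q : ZMod n) : MvPolynomial (Prp n × ZMod n) ℝ :=
  if q ∈ supp n p then MvPolynomial.X (p, q) else 0

/-- The column paired with the row `p` in the minors determined by `I_i^W`. -/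
noncomputable def colOf (P : Finset (Prp n)) (i : ZMod n) (p : Prp n) : ZMod n :=
  (gnAssign n P i p).getD i

/-- `Δ_{I_i}`: the determinant of the `k × k` minor of `C(W)` on the columns
indexed by `I_i^W`, rows and columns paired via the necklace assignment. -/
noncomputable def Delta (P : Finset (Prp n)) (i : ZMod n) :
    MvPolynomial (Prp n × ZMod n) ℝ :=
  Matrix.det (Matrix.of fun p q : ↥P => CW n (p : Prp n) (colOf n P i (q : Prp n)))

/-- `S_i`: the propagators whose contribution changes from `I_{i-1}` to `I_i`. -/
noncomputable def Schanged (P : Finset (Prp n)) (i : ZMod n) : Finset (Prp n) :=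
  P.filter fun p => gnAssign n P (i - 1) p ≠ gnAssign n P i p

/-- `r_i`: the determinant of the minor of `C(W)` with rows indexed by `S_i` and
columns indexed by `I_i(S_i)` (equal to `1` when `S_i = ∅`). -/
noncomputable def rfac (P : Finset (Prp n)) (i : ZMod n) :
    MvPolynomial (Prp n × ZMod n) ℝ :=
  Matrix.det
    (Matrix.of fun p q : ↥(Schanged n P i) => CW n (p : Prp n) (colOf n P i (q : Prp n)))

/-- `R = ∏ᵢ rᵢ`, the polynomial produced by the algorithm. -/
noncomputable def Rpoly [NeZero n] (P : Finset (Prp n)) :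
    MvPolynomial (Prp n × ZMod n) ℝ :=
  ∏ i : ZMod n, rfac n P i

/-- Position of the end of the propagator `p` along the edge `e`: larger values
attach closer to the vertex `e`, i.e. earlier in the counterclockwise ordering
of the ends of propagators along the edge `e`. -/
noncomputable def edgeKey (e : ZMod n) (p : Prp n) : ℕ := ord n e (otherEnd n p e)

/-- The propagators of `P` with an end on the edge `e`. -/
noncomputable def onEdge (P : Finset (Prp n)) (e : ZMod n) : Finset (Prp n) :=
  P.filter fun p => e ∈ p

/-- `p` is the first propagator (`p₁`) on the edge `e` in the counterclockwise
ordering of the propagators with an end on the edge `e`. -/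
def IsCcwFirst (P : Finset (Prp n)) (e : ZMod n) (p : Prp n) : Prop :=
  p ∈ onEdge n P e ∧ ∀ q ∈ onEdge n P e, edgeKey n e q ≤ edgeKey n e p

/-- `p` is the last propagator (`p_r`) on the edge `e` in the counterclockwise
ordering of the propagators with an end on the edge `e`. -/
def IsCcwLast (P : Finset (Prp n)) (e : ZMod n) (p : Prp n) : Prop :=
  p ∈ onEdge n P e ∧ ∀ q ∈ onEdge n P e, edgeKey n e p ≤ edgeKey n e q

/-- `p` and `q` are consecutive, in this order (`p = p_j`, `q = p_{j+1}`), in the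
counterclockwise ordering of the propagators with an end on the edge `e`. -/
def ConsecOnEdge (P : Finset (Prp n)) (e : ZMod n) (p q : Prp n) : Prop :=
  p ∈ onEdge n P e ∧ q ∈ onEdge n P e ∧ edgeKey n e q < edgeKey n e p ∧
    ∀ r ∈ onEdge n P e, ¬ (edgeKey n e q < edgeKey n e r ∧ edgeKey n e r < edgeKey n e p)

/-- The factor `R_e` of the denominator `R(W)` associated to the edge `e`:
`R_e = x_{p₁,e+1} • ∏_{j=1}^{r-1} (x_{p_j,e} x_{p_{j+1},e+1} - x_{p_{j+1},e} x_{p_j,e+1}) • x_{p_r,e}`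
for the counterclockwise ordering `p₁, …, p_r` of the propagators on the edge `e`
(`R_e = 1` if there are none). -/
noncomputable def Redge (P : Finset (Prp n)) (e : ZMod n) :
    MvPolynomial (Prp n × ZMod n) ℝ :=
  (∏ p ∈ (onEdge n P e).filter (IsCcwFirst n P e), MvPolynomial.X (p, e + 1)) *
    (∏ pq ∈ (P ×ˢ P).filter (fun pq => ConsecOnEdge n P e pq.1 pq.2),
      (MvPolynomial.X (pq.1, e) * MvPolynomial.X (pq.2, e + 1) -
        MvPolynomial.X (pq.2, e) * MvPolynomial.X (pq.1, e + 1))) *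
    (∏ p ∈ (onEdge n P e).filter (IsCcwLast n P e), MvPolynomial.X (p, e))

/-- The denominator `R(W) = ∏ₑ R_e` of the integrand `Ω(W)`. -/
noncomputable def RW [NeZero n] (P : Finset (Prp n)) :
    MvPolynomial (Prp n × ZMod n) ℝ :=
  ∏ e : ZMod n, Redge n P e

/-- The relabelling map associated to the removal of the vertex `i` from the
vertex set `ZMod n`: the vertex of `ZMod (n-1)` in position `t` (in the `<₁`
order) is sent to the vertex of `ZMod n` in position `t` if `t` precedes the
position of `i`, and to the vertex in position `t+1` otherwise. -/
noncomputable def liftVert (i : ZMod n) (x : ZMod (n - 1)) : ZMod n :=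
  1 + ((if ord (n - 1) 1 x < ord n 1 i then ord (n - 1) 1 x
        else ord (n - 1) 1 x + 1 : ℕ) : ZMod n)

end WLD

namespace WLD

/-- The number of steps by which a propagator with ends at positions `l < r` is preferred at
position `v ≥ 1`: the value of `cwKey` expressed in positions relative to the start vertex. -/
def posKey (n l r v : ℕ) : ℕ :=
  if r + 1 = v then 2 * n + l - r
  else if l + 1 = v then n + r - l
  else if r = v then n + l - r
  else r - l

/-- If two chords are supported at `v`, then the preferred one (with ends `l` and `r`) either ends
next to `v` or starts there, and the position of the other one is constrained accordingly. -/
theorem posKey_le_cases {n l r l' r' v : ℕ} (h : l + 1 < r) (h' : l' + 1 < r') (hr : r < n)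
    (hr' : r' < n) (hv : v = l ∨ v = l + 1 ∨ v = r ∨ v = r + 1)
    (hv' : v = l' ∨ v = l' + 1 ∨ v = r' ∨ v = r' + 1)
    (hk : posKey n l' r' v ≤ posKey n l r v) :
    (v = r + 1 ∧ (r' = r ∧ l' ≤ l ∨ l' = r ∨ r' = r + 1 ∨ l' = r + 1)) ∨
    (v = r ∧ (r' = r ∧ l' ≤ l ∨ l' = r)) ∨
    (v = l + 1 ∧ (l' = l ∧ r' ≤ r ∨ r' = l + 1 ∨ l' = l + 1)) ∨
    (v = l ∧ l' = l ∧ r' ≤ r) := by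
  unfold posKey at hk
  rcases hv with rfl | rfl | rfl | rfl <;> rcases hv' with hv | hv | hv | hv <;>
    split_ifs at hk <;> omega

/-- Combinatorial core: chords with ends at positions `L x < R x`, chord `x` being served at time
`f x`, with the larger `posKey` served first. An unserved chord `p` lies in a set `Q` of chords
whose supports are exhausted by services of members of `Q`, up to three vertices. -/
theorem exists_exhausted_set {α : Type*} (n : ℕ) (P : Finset α) (L R f : α → ℕ)
    (hLR : ∀ x ∈ P, L x + 1 < R x) (hRn : ∀ x ∈ P, R x < n)
    (hnc : ∀ x ∈ P, ∀ y ∈ P, ¬ (L x < L y ∧ L y < R x ∧ R x < R y))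
    (hinj : ∀ x ∈ P, ∀ y ∈ P, L x = L y → R x = R y → x = y)
    (hsupp : ∀ x ∈ P, f x < n → 1 ≤ f x →
      f x = L x ∨ f x = L x + 1 ∨ f x = R x ∨ f x = R x + 1)
    (hex : ∀ x ∈ P, ∀ v, v < n → v < f x →
      (v = L x ∨ v = L x + 1 ∨ v = R x ∨ v = R x + 1) → ∃ y ∈ P, f y = v)
    (hkey : ∀ x ∈ P, ∀ y ∈ P, f y < n → 1 ≤ f y → f y < f x →
      (f y = L x ∨ f y = L x + 1 ∨ f y = R x ∨ f y = R x + 1) →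
      posKey n (L x) (R x) (f y) ≤ posKey n (L y) (R y) (f y))
    (p : α) (hp : p ∈ P) (hfp : n ≤ f p) :
    ∃ Q ⊆ P, p ∈ Q ∧ ∀ x ∈ Q, ∀ w, (w = L x ∨ w = L x + 1 ∨ w = R x ∨ w = R x + 1) →
      w = L p ∨ w = L p + 1 ∨ w = n ∨ ∃ y ∈ Q, y ≠ p ∧ f y = w := by
  let r : α → α → Prop := fun x y => y ∈ P ∧ f y < n ∧ f y < f x ∧
    f y ≠ L p ∧ f y ≠ L p + 1 ∧
    (f y = L x ∨ f y = L x + 1 ∨ f y = R x ∨ f y = R x + 1)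
  let Reach := Relation.ReflTransGen r p
  have hstep : ∀ x y, x ∈ P → L p ≤ L x → R x ≤ R p → r x y →
      L p ≤ L y ∧ R y ≤ R p ∧ 1 ≤ f y := by
    rintro x y hx h1 h2 ⟨hy, h3, h4, h5, h6, h7⟩
    have a1 := hLR x hx
    have a2 := hLR y hy
    have a3 := hLR p hp
    have b1 := hRn x hx
    have b2 := hRn y hy
    have hpos : 1 ≤ f y := by omega
    have k := hkey x hx y hy h3 hpos h4 h7
    have s := hsupp y hy h3 hpos
    have c1 := hnc p hp y hy
    have c2 := hnc y hy p hp
    rcases posKey_le_cases a2 a1 b2 b1 s h7 k with ⟨_, h⟩ | ⟨_, h⟩ | ⟨_, h⟩ | ⟨_, h⟩ <;> omega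
  have hreach : ∀ x, Reach x → x ∈ P ∧ L p ≤ L x ∧ R x ≤ R p := by
    intro x hx
    induction hx with
    | refl => exact ⟨hp, le_rfl, le_rfl⟩
    | tail _ hxy ih =>
      have := hstep _ _ ih.1 ih.2.1 ih.2.2 hxy
      exact ⟨hxy.1, this.1, this.2.1⟩
  let Cover : ℕ → Prop := fun w => w = L p ∨ w = L p + 1 ∨ w = n ∨
    ∃ y, Reach y ∧ (w = L y ∨ w = L y + 1 ∨ w = R y ∨ w = R y + 1) ∧ w ≤ f y
  -- A chord opening at its service time encloses only chords reached through its far end.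
  have hinside : ∀ q ∈ P, L p ≤ L q → R q ≤ R p → q ≠ p →
      (f q = L q ∨ f q = L q + 1) → ∀ x, Reach x → L q ≤ L x → R x ≤ R q → x ≠ q →
      Cover (R q) ∧ Cover (R q + 1) := by
    intro q hq hq1 hq2 hqp hfq x hx
    induction hx with
    | refl =>
      intro h1 h2 _
      exact absurd (hinj q hq p hp (by omega) (by omega)) hqp
    | @tail x' x hx' hr ih =>
      intro h1 h2 hne
      by_cases hT : L q ≤ L x' ∧ R x' ≤ R q ∧ x' ≠ q
      · exact ih hT.1 hT.2.1 hT.2.2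
      obtain ⟨g1, g2, g3⟩ := hreach x' hx'
      have hpos := (hstep x' x g1 g2 g3 hr).2.2
      have hxr : Reach x := hx'.tail hr
      obtain ⟨hxP, h3, h4, h5, h6, h7⟩ := hr
      have a1 := hLR x hxP
      have a2 := hLR x' g1
      have a3 := hLR q hq
      have b1 := hRn x hxP
      have b2 := hRn x' g1
      have b3 := hRn q hq
      have k := hkey x' g1 x hxP h3 hpos h4 h7
      have s := hsupp x hxP h3 hpos
      have c1 := hnc q hq x' g1
      have c2 := hnc x' g1 q hq
      have e1 : ¬ (L q = L x ∧ R q = R x) := fun h => hne (hinj q hq x hxP h.1 h.2).symm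
      have hT' : L x' < L q ∨ R q < R x' ∨ (L x' = L q ∧ R x' = R q ∧ f x' = f q) := by
        by_contra hcon
        apply hT
        refine ⟨by omega, by omega, fun h => hcon ?_⟩
        subst h
        exact Or.inr (Or.inr ⟨rfl, rfl, rfl⟩)
      have main : f x = R q ∧ (R q = R x' ∨ R q = L x') ∨
          f x = R q + 1 ∧ (R q = R x' ∨ R q = L x' ∨ R q = R x) := by
        rcases posKey_le_cases a1 a2 b1 b2 s h7 k with
          ⟨_, h⟩ | ⟨_, h⟩ | ⟨_, h⟩ | ⟨_, h⟩ <;> clear k s h7 <;> omega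
      constructor
      · by_cases hc : R q = R x' ∨ R q = L x'
        · exact Or.inr (Or.inr (Or.inr ⟨x', hx', by omega, by omega⟩))
        · exact Or.inr (Or.inr (Or.inr ⟨x, hxr, by omega, by omega⟩))
      · exact Or.inr (Or.inr (Or.inr ⟨x', hx', by omega, by omega⟩))
  have hcover : ∀ x, Reach x → ∀ w, (w = L x ∨ w = L x + 1 ∨ w = R x ∨ w = R x + 1) →
      Cover w := by
    intro x hx
    induction hx with
    | refl =>
      intro w hw
      have h1 := hRn p hp
      have h2 := hLR p hp
      exact Or.inr (Or.inr (Or.inr ⟨p, Relation.ReflTransGen.refl, hw, by omega⟩))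
    | @tail x' x hx' hr ih =>
      intro w hw
      obtain ⟨g1, g2, g3⟩ := hreach x' hx'
      obtain ⟨i1, i2, hpos⟩ := hstep x' x g1 g2 g3 hr
      have hxr : Reach x := hx'.tail hr
      by_cases hle : w ≤ f x
      · exact Or.inr (Or.inr (Or.inr ⟨x, hxr, hw, hle⟩))
      obtain ⟨hxP, h3, h4, h5, h6, h7⟩ := hr
      have a1 := hLR x hxP
      have a2 := hLR x' g1
      have b1 := hRn x hxP
      have b2 := hRn x' g1
      have k := hkey x' g1 x hxP h3 hpos h4 h7
      have s := hsupp x hxP h3 hpos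
      have c1 := hnc x hxP x' g1
      have c2 := hnc x' g1 x hxP
      by_cases hw' : w = L x' ∨ w = L x' + 1 ∨ w = R x' ∨ w = R x' + 1
      · exact ih w hw'
      have hne : x' ≠ x := by rintro rfl; omega
      have hxp : x ≠ p := by rintro rfl; omega
      have main : (f x = L x ∨ f x = L x + 1) ∧ L x ≤ L x' ∧ R x' ≤ R x ∧
          (w = R x ∨ w = R x + 1) := by
        rcases posKey_le_cases a1 a2 b1 b2 s h7 k with
          ⟨_, h⟩ | ⟨_, h⟩ | ⟨_, h⟩ | ⟨_, h⟩ <;> clear k s h7 <;> omega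
      obtain ⟨m1, m2, m3, m4⟩ := main
      have := hinside x hxP i1 i2 hxp m1 x' hx' m2 m3 hne
      rcases m4 with rfl | rfl
      · exact this.1
      · exact this.2
  refine ⟨P.filter Reach, Finset.filter_subset _ _,
    Finset.mem_filter.2 ⟨hp, Relation.ReflTransGen.refl⟩, ?_⟩
  intro x hx w hw
  have hxr := (Finset.mem_filter.1 hx).2
  rcases hcover x hxr w hw with h | h | h | ⟨y, hy, hwy, hle⟩
  · exact Or.inl h
  · exact Or.inr (Or.inl h)
  · exact Or.inr (Or.inr (Or.inl h))
  by_cases hw0 : w = L p ∨ w = L p + 1 ∨ w = n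
  · tauto
  right; right; right
  obtain ⟨hyP, hy1, hy2⟩ := hreach y hy
  have hwn : w < n := by
    have := hRn y hyP
    have := hLR y hyP
    omega
  rcases hle.lt_or_eq with hlt | heq
  · obtain ⟨z, hz, hzw⟩ := hex y hyP w hwn hlt hwy
    have hzr : Reach z := hy.tail ⟨hz, by omega, by omega, by omega, by omega, by omega⟩
    exact ⟨z, Finset.mem_filter.2 ⟨hz, hzr⟩, by rintro rfl; omega, hzw⟩
  · exact ⟨y, Finset.mem_filter.2 ⟨hyP, hy⟩, by rintro rfl; omega, heq.symm⟩

section Positions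

variable {n : ℕ}

theorem ord_lt [NeZero n] (i x : ZMod n) : ord n i x < n := ZMod.val_lt _

theorem add_ord [NeZero n] (i x : ZMod n) : i + (ord n i x : ZMod n) = x := by
  simp [ord]

theorem ord_add_add (i : ZMod n) {a b : ℕ} (ha : a < n) (hb : b < n) :
    ord n (i + a) (i + b) = if a ≤ b then b - a else b + n - a := by
  have h : ∀ c : ℕ, c < n → (b : ZMod n) - a = c → ord n (i + a) (i + b) = c := by
    intro c hc h
    rw [ord, add_sub_add_left_eq_sub, h, ZMod.val_natCast, Nat.mod_eq_of_lt hc]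
  split_ifs with hab
  · exact h _ (by omega) (by rw [Nat.cast_sub hab])
  · exact h _ (by omega) (by rw [Nat.cast_sub (by omega)]; simp)

theorem natCast_inj_of_lt {a b : ℕ} (ha : a < n) (hb : b < n) :
    (a : ZMod n) = b ↔ a = b := by
  rw [ZMod.natCast_eq_natCast_iff', Nat.mod_eq_of_lt ha, Nat.mod_eq_of_lt hb]

/-- The position, relative to `i`, of the first end of a propagator. -/
def lowEnd (i : ZMod n) (p : Prp n) : ℕ := (p.map (ord n i)).inf

/-- The position, relative to `i`, of the last end of a propagator. -/
def highEnd (i : ZMod n) (p : Prp n) : ℕ := (p.map (ord n i)).sup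

theorem eq_mk_ends [NeZero n] (i : ZMod n) (p : Prp n) :
    p = s(i + (lowEnd i p : ZMod n), i + (highEnd i p : ZMod n)) := by
  induction p using Sym2.ind with
  | _ x y =>
    simp only [lowEnd, highEnd, Sym2.map_mk, Sym2.inf_mk, Sym2.sup_mk]
    rcases le_total (ord n i x) (ord n i y) with h | h
    · simp [h, add_ord]
    · simp [h, add_ord, Sym2.eq_swap]

theorem lowEnd_le_highEnd (i : ZMod n) (p : Prp n) : lowEnd i p ≤ highEnd i p := by
  induction p using Sym2.ind with
  | _ x y => simp [lowEnd, highEnd]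

theorem highEnd_lt [NeZero n] (i : ZMod n) (p : Prp n) : highEnd i p < n := by
  induction p using Sym2.ind with
  | _ x y => simp [highEnd, ord_lt]

theorem mem_supp_iff [NeZero n] (i : ZMod n) (p : Prp n) (x : ZMod n) :
    x ∈ supp n p ↔ x = i + (lowEnd i p : ZMod n) ∨ x = i + ((lowEnd i p + 1 : ℕ) : ZMod n) ∨
      x = i + (highEnd i p : ZMod n) ∨ x = i + ((highEnd i p + 1 : ℕ) : ZMod n) := by
  conv_lhs => rw [eq_mk_ends i p]
  simp [supp, add_assoc]

theorem otherEnd_left (x y : ZMod n) : otherEnd n s(x, y) x = y := by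
  have h : x ∈ s(x, y) := Sym2.mem_mk_left x y
  rw [otherEnd, dif_pos h]
  exact Sym2.congr_right.1 (Sym2.other_spec h)

theorem otherEnd_right (x y : ZMod n) : otherEnd n s(x, y) y = x := by
  rw [Sym2.eq_swap, otherEnd_left]

theorem cwKey_eq_posKey [NeZero n] (i : ZMod n) (p : Prp n) (hlt : lowEnd i p + 1 < highEnd i p) {v : ℕ}
    (hv : 1 ≤ v) (hvn : v < n)
    (hvp : v = lowEnd i p ∨ v = lowEnd i p + 1 ∨ v = highEnd i p ∨ v = highEnd i p + 1) :
    cwKey n (i + v) p = posKey n (lowEnd i p) (highEnd i p) v := by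
  have hR := highEnd_lt i p
  have hp := eq_mk_ends i p
  generalize lowEnd i p = l at *
  generalize highEnd i p = r at *
  subst hp
  have hprev : i + (v : ZMod n) - 1 = i + ((v - 1 : ℕ) : ZMod n) := by
    rw [Nat.cast_sub hv]; push_cast; ring
  have hmem : (i + (v : ZMod n) - 1 ∈ s(i + (l : ZMod n), i + (r : ZMod n))) ↔
      v - 1 = l ∨ v - 1 = r := by
    rw [hprev, Sym2.mem_iff, add_right_inj, add_right_inj,
      natCast_inj_of_lt (by omega) (by omega), natCast_inj_of_lt (by omega) (by omega)]
  unfold cwKey posKey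
  simp only [hmem]
  rw [hprev]
  by_cases h1 : r + 1 = v
  · subst h1
    rw [if_pos (by simp), if_pos rfl, Nat.add_sub_cancel, otherEnd_right,
      ord_add_add i hR (by omega), if_neg (by omega)]
    omega
  by_cases h2 : l + 1 = v
  · subst h2
    rw [if_pos (by simp), if_neg h1, if_pos rfl, Nat.add_sub_cancel, otherEnd_left,
      ord_add_add i (by omega) hR, if_pos (by omega)]
    omega
  rw [if_neg (by omega), if_neg h1, if_neg h2]
  by_cases h3 : r = v
  · subst h3
    rw [if_pos rfl, otherEnd_right, ord_add_add i hR (by omega), if_neg (by omega)]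
    omega
  · obtain rfl : v = l := by omega
    rw [if_neg h3, otherEnd_left, ord_add_add i hvn hR, if_pos (by omega)]

theorem not_interleaved [NeZero n] {P : Finset (Prp n)} (h : ∀ p ∈ P, ∀ q ∈ P, ¬ Crossing n p q)
    (i : ZMod n) {p q : Prp n} (hp : p ∈ P) (hq : q ∈ P) :
    ¬ (lowEnd i p < lowEnd i q ∧ lowEnd i q < highEnd i p ∧ highEnd i p < highEnd i q) := by
  rintro ⟨h1, h2, h3⟩
  have hR := highEnd_lt i q
  refine h p hp q hq ⟨_, _, _, _, eq_mk_ends i p, eq_mk_ends i q, ?_⟩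
  rw [ord_add_add i (by omega) (by omega), ord_add_add i (by omega) (by omega),
    ord_add_add i (by omega) (by omega), if_pos (by omega), if_pos (by omega),
    if_pos (by omega)]
  omega

theorem lowEnd_add_one_lt_highEnd [NeZero n] {P : Finset (Prp n)}
    (h : ∀ Q ⊆ P, Q.Nonempty → Q.card + 3 ≤ (suppSet n Q).card) (i : ZMod n) {p : Prp n}
    (hp : p ∈ P) : lowEnd i p + 1 < highEnd i p := by
  by_contra hcon
  have h1 := h {p} (by simpa using hp) (by simp)
  have hsub : suppSet n {p} ⊆ {i + (lowEnd i p : ZMod n),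
      i + ((lowEnd i p + 1 : ℕ) : ZMod n), i + ((lowEnd i p + 2 : ℕ) : ZMod n)} := by
    intro x hx
    rw [suppSet, Finset.singleton_biUnion, mem_supp_iff i] at hx
    have hle := lowEnd_le_highEnd i p
    have hR : highEnd i p = lowEnd i p ∨ highEnd i p = lowEnd i p + 1 := by omega
    simp only [Finset.mem_insert, Finset.mem_singleton]
    rcases hR with hR | hR <;> rw [hR] at hx <;> tauto
  have h2 := (Finset.card_le_card hsub).trans Finset.card_le_three
  rw [Finset.card_singleton] at h1
  omega

end Positions

section Run

variable {n : ℕ}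

theorem pickCW_eq_some {S : Finset (Prp n)} {a : ZMod n} {p : Prp n}
    (h : pickCW n S a = some p) :
    p ∈ S ∧ a ∈ supp n p ∧ ∀ q ∈ S, a ∈ supp n q → cwKey n a q ≤ cwKey n a p := by
  unfold pickCW at h
  split_ifs at h with hne
  have hs := Classical.choose_spec
    ((S.filter fun p => a ∈ supp n p).exists_max_image (cwKey n a) hne)
  rw [Option.some.inj h] at hs
  obtain ⟨h1, h2⟩ := hs
  rw [Finset.mem_filter] at h1
  exact ⟨h1.1, h1.2, fun q hq ha => h2 q (Finset.mem_filter.2 ⟨hq, ha⟩)⟩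

theorem exists_pickCW_eq_some {S : Finset (Prp n)} {a : ZMod n} {p : Prp n}
    (hp : p ∈ S) (ha : a ∈ supp n p) : ∃ q, pickCW n S a = some q := by
  unfold pickCW
  rw [dif_pos ⟨p, Finset.mem_filter.2 ⟨hp, ha⟩⟩]
  exact ⟨_, rfl⟩

/-- `p` is the propagator deleted when the vertex `i + t` is visited. -/
def DeletedAt (P : Finset (Prp n)) (i : ZMod n) (p : Prp n) (t : ℕ) : Prop :=
  pickCW n (gnRun n P i t).1 (i + (t : ZMod n)) = some p

theorem mem_gnRun_iff (P : Finset (Prp n)) (i : ZMod n) (p : Prp n) (t : ℕ) :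
    p ∈ (gnRun n P i t).1 ↔ p ∈ P ∧ ∀ s < t, ¬ DeletedAt P i p s := by
  induction t with
  | zero => simp [gnRun]
  | succ t ih =>
    simp only [Nat.forall_lt_succ_right, ← and_assoc, ← ih]
    rcases h : pickCW n (gnRun n P i t).1 (i + (t : ZMod n)) with _ | q
    · simp [gnRun, h, DeletedAt]
    · simp [gnRun, h, DeletedAt, and_comm, eq_comm]

theorem DeletedAt.mem {P : Finset (Prp n)} {i : ZMod n} {p : Prp n} {t : ℕ}
    (h : DeletedAt P i p t) : p ∈ P :=
  ((mem_gnRun_iff P i p t).1 (pickCW_eq_some h).1).1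

theorem DeletedAt.unique {P : Finset (Prp n)} {i : ZMod n} {p : Prp n} {s t : ℕ}
    (hs : DeletedAt P i p s) (ht : DeletedAt P i p t) : s = t := by
  have h1 := ((mem_gnRun_iff P i p s).1 (pickCW_eq_some hs).1).2
  have h2 := ((mem_gnRun_iff P i p t).1 (pickCW_eq_some ht).1).2
  rcases lt_trichotomy s t with h | h | h
  · exact absurd hs (h2 s h)
  · exact h
  · exact absurd ht (h1 t h)

theorem gnRun_snd_eq_some_iff (P : Finset (Prp n)) (i : ZMod n) (p : Prp n) (t : ℕ)
    (w : ZMod n) :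
    (gnRun n P i t).2 p = some w ↔ ∃ s < t, DeletedAt P i p s ∧ w = i + (s : ZMod n) := by
  induction t with
  | zero => simp [gnRun]
  | succ t ih =>
    rw [Nat.exists_lt_succ_right, ← ih]
    rcases h : pickCW n (gnRun n P i t).1 (i + (t : ZMod n)) with _ | q
    · simp [gnRun, h, DeletedAt]
    · by_cases hq : p = q
      · subst hq
        have hnone : ¬ (gnRun n P i t).2 p = some w := by
          rw [ih]
          rintro ⟨s, hs, hd, -⟩
          exact hs.ne (hd.unique h)
        simp [gnRun, h, DeletedAt, hnone, eq_comm]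
      · simp [gnRun, h, DeletedAt, hq, Ne.symm hq]

/-- The step at which `p` is deleted, or `n` if it is not deleted within one circuit. -/
noncomputable def deletionTime (P : Finset (Prp n)) (i : ZMod n) (p : Prp n) : ℕ :=
  if h : ∃ t < n, DeletedAt P i p t then h.choose else n

theorem DeletedAt.deletionTime_eq {P : Finset (Prp n)} {i : ZMod n} {p : Prp n} {t : ℕ}
    (h : DeletedAt P i p t) (ht : t < n) : deletionTime P i p = t := by
  have hex : ∃ t < n, DeletedAt P i p t := ⟨t, ht, h⟩
  rw [deletionTime, dif_pos hex]
  exact hex.choose_spec.2.unique h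

theorem deletedAt_deletionTime {P : Finset (Prp n)} {i : ZMod n} {p : Prp n}
    (h : deletionTime P i p < n) : DeletedAt P i p (deletionTime P i p) := by
  by_cases hex : ∃ t < n, DeletedAt P i p t
  · rw [deletionTime, dif_pos hex]
    exact hex.choose_spec.2
  · rw [deletionTime, dif_neg hex] at h
    exact absurd h (lt_irrefl n)

theorem mem_gnRun_of_lt_deletionTime {P : Finset (Prp n)} {i : ZMod n} {p : Prp n} {t : ℕ}
    (hp : p ∈ P) (htn : t < n) (ht : t < deletionTime P i p) : p ∈ (gnRun n P i t).1 :=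
  (mem_gnRun_iff P i p t).2 ⟨hp, fun s hs hd => by
    have := hd.deletionTime_eq (hs.trans htn)
    omega⟩

end Run

theorem deletionTime_lt {n : ℕ} [NeZero n] {P : Finset (Prp n)} (hadm : IsAdmissible n P)
    (i : ZMod n) {p : Prp n} (hp : p ∈ P) : deletionTime P i p < n := by
  have hLR : ∀ x ∈ P, lowEnd i x + 1 < highEnd i x :=
    fun x hx => lowEnd_add_one_lt_highEnd hadm.dense i hx
  have hmem : ∀ (x : Prp n) (v : ℕ), (v = lowEnd i x ∨ v = lowEnd i x + 1 ∨
      v = highEnd i x ∨ v = highEnd i x + 1) → i + (v : ZMod n) ∈ supp n x := by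
    intro x v hv
    rw [mem_supp_iff i]
    rcases hv with h | h | h | h <;> simp [h]
  have hpos : ∀ (x : Prp n) (v : ℕ), lowEnd i x + 1 < highEnd i x → v < n → 1 ≤ v →
      i + (v : ZMod n) ∈ supp n x → (v = lowEnd i x ∨ v = lowEnd i x + 1 ∨
      v = highEnd i x ∨ v = highEnd i x + 1) := by
    intro x v hx hv hv1 h
    have hR := highEnd_lt i x
    rw [mem_supp_iff i, add_right_inj, add_right_inj, add_right_inj, add_right_inj,
      natCast_inj_of_lt hv (by omega), natCast_inj_of_lt hv (by omega),
      natCast_inj_of_lt hv hR] at h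
    rcases h with h | h | h | h
    · exact Or.inl h
    · exact Or.inr (Or.inl h)
    · exact Or.inr (Or.inr (Or.inl h))
    · rcases (show highEnd i x + 1 ≤ n from hR).lt_or_eq with h' | h'
      · exact Or.inr (Or.inr (Or.inr ((natCast_inj_of_lt hv h').1 h)))
      · rw [h', ZMod.natCast_self, ← Nat.cast_zero, natCast_inj_of_lt hv (by omega)] at h
        omega
  by_contra hcon
  obtain ⟨Q, hQP, hpQ, hQ⟩ := exists_exhausted_set n P (lowEnd i) (highEnd i)
    (deletionTime P i) hLR (fun x _ => highEnd_lt i x)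
    (fun x hx y hy => not_interleaved hadm.noncross i hx hy)
    (fun x _ y _ h1 h2 => by rw [eq_mk_ends i x, eq_mk_ends i y, h1, h2])
    (fun x hx hlt h1 => hpos x _ (hLR x hx) hlt h1
      (pickCW_eq_some (deletedAt_deletionTime hlt)).2.1)
    (fun x hx v hv hvx hvs => by
      obtain ⟨y, hy⟩ := exists_pickCW_eq_some (mem_gnRun_of_lt_deletionTime hx hv hvx)
        (hmem x v hvs)
      have hy : DeletedAt P i y v := hy
      exact ⟨y, hy.mem, hy.deletionTime_eq hv⟩)
    (fun x hx y hy hlt h1 hlt' hs => by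
      have hd := pickCW_eq_some (deletedAt_deletionTime hlt)
      have hk := hd.2.2 x (mem_gnRun_of_lt_deletionTime hx hlt hlt') (hmem x _ hs)
      rwa [cwKey_eq_posKey i x (hLR x hx) h1 hlt hs,
        cwKey_eq_posKey i y (hLR y hy) h1 hlt (hpos y _ (hLR y hy) hlt h1 hd.2.1)] at hk)
    p hp (not_lt.1 hcon)
  have hsub : suppSet n Q ⊆ {i + (lowEnd i p : ZMod n), i + ((lowEnd i p + 1 : ℕ) : ZMod n), i} ∪
      (Q.erase p).image fun y => i + (deletionTime P i y : ZMod n) := by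
    intro x hx
    rw [suppSet, Finset.mem_biUnion] at hx
    obtain ⟨q, hq, hxq⟩ := hx
    have hw : ∃ w : ℕ, x = i + (w : ZMod n) ∧ (w = lowEnd i q ∨ w = lowEnd i q + 1 ∨
        w = highEnd i q ∨ w = highEnd i q + 1) := by
      rw [mem_supp_iff i] at hxq
      rcases hxq with h | h | h | h <;> exact ⟨_, h, by simp⟩
    obtain ⟨w, rfl, hw⟩ := hw
    simp only [Finset.mem_union, Finset.mem_insert, Finset.mem_singleton, Finset.mem_image,
      Finset.mem_erase]
    rcases hQ q hq w hw with rfl | rfl | rfl | ⟨y, hy, hyp, rfl⟩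
    · simp
    · simp
    · simp
    · exact Or.inr ⟨y, ⟨hyp, hy⟩, rfl⟩
  have h1 := hadm.dense Q hQP ⟨p, hpQ⟩
  have h2 := (Finset.card_le_card hsub).trans ((Finset.card_union_le _ _).trans
    (add_le_add Finset.card_le_three Finset.card_image_le))
  have h3 := Finset.card_erase_add_one hpQ
  omega

/-- the algorithm terminates within one full circuit.
If `W` is an admissible Wilson loop diagram with `k` propagators and `n`
vertices, then for every starting vertex `i` the Grassmann necklace algorithm
terminates in at most `n` steps (the run of `n` steps, one full circuit of the
vertices, assigns a vertex to every propagator) and assigns exactly `k` distinct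
vertices, so that `|I_i^W| = k`. -/
theorem gnAlgorithm_terminates_and_card
    (n : ℕ) [NeZero n] (P : Finset (Prp n)) (hadm : IsAdmissible n P) :
    ∀ i : ZMod n, (∀ p ∈ P, ∃ v : ZMod n, gnAssign n P i p = some v) ∧
      (gnSet n P i).card = P.card := by
  intro i
  have hlt : ∀ p ∈ P, deletionTime P i p < n := fun p hp => deletionTime_lt hadm i hp
  have hassign : ∀ p ∈ P, gnAssign n P i p = some (i + (deletionTime P i p : ZMod n)) :=
    fun p hp => (gnRun_snd_eq_some_iff P i p n _).2
      ⟨_, hlt p hp, deletedAt_deletionTime (hlt p hp), rfl⟩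
  refine ⟨fun p hp => ⟨_, hassign p hp⟩, ?_⟩
  have hset : gnSet n P i = P.image fun p => i + (deletionTime P i p : ZMod n) := by
    ext v
    simp only [gnSet, Finset.mem_filter, Finset.mem_univ, true_and, Finset.mem_image]
    constructor
    · rintro ⟨p, hp⟩
      obtain ⟨s, hs, hd, rfl⟩ := (gnRun_snd_eq_some_iff P i p n v).1 hp
      exact ⟨p, hd.mem, by rw [hd.deletionTime_eq hs]⟩
    · rintro ⟨p, hp, rfl⟩
      exact ⟨p, hassign p hp⟩
  rw [hset, Finset.card_image_of_injOn]
  intro p hp q hq hpq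
  have hpq := (natCast_inj_of_lt (hlt p hp) (hlt q hq)).1 (add_left_cancel hpq)
  have hdp : DeletedAt P i p _ := deletedAt_deletionTime (hlt p hp)
  have hdq : DeletedAt P i q _ := deletedAt_deletionTime (hlt q hq)
  rw [hpq] at hdp
  exact Option.some.inj (hdp.symm.trans hdq)

end WLD
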